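/- arXiv:1003.5983 — 2 statements merged into one kernel-verified Lean document; each statement's English description precedes it below -/
import Mathlib

section
/- Let D ⊆ [ω]^ω × ℕ^ℕ be a closed set and let A ⊆ [ω]^ω be its projection onto [ω]^ω. Then A is Ramsey positive if and only if there exist a finite set σ ⊆ ℕ, an infinite set s ⊆ ℕ with max σ < min s, and a continuous function f : [σ,s] → ℕ^ℕ such that (a, f(a)) ∈ D for every a ∈ [σ,s]. -/
open MeasureTheory TopologicalSpace

/-- The space `[ω]^ω` of infinite subsets of `ℕ`, topologized as a subspace of the
Cantor space `ℕ → Bool` via characteristic functions. -/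
abbrev IOI := {x : ℕ → Bool // {n | x n = true}.Infinite}

/-- A set is `Σ¹₂` if it is the image of a coanalytic subset of Baire space under a
continuous map. -/
def Sigma12 {X : Type*} [TopologicalSpace X] (A : Set X) : Prop :=
  ∃ (C : Set (ℕ → ℕ)) (f : (ℕ → ℕ) → X),
    MeasureTheory.AnalyticSet Cᶜ ∧ Continuous f ∧ f '' C = A

/-- A topological space is zero-dimensional if it has a basis of clopen sets. -/
def ZeroDim (X : Type*) [TopologicalSpace X] : Prop :=
  ∃ b : Set (Set X), (∀ s ∈ b, IsClopen s) ∧ TopologicalSpace.IsTopologicalBasis b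

/-- `A` is `Σ¹₂`-complete: `A` is `Σ¹₂` and every `Σ¹₂` subset of a zero-dimensional
Polish space is a continuous preimage of `A`. -/
def Sigma12Complete {X : Type*} [TopologicalSpace X] (A : Set X) : Prop :=
  Sigma12 A ∧
  ∀ (Z : Type) [TopologicalSpace Z] [PolishSpace Z], ZeroDim Z →
    ∀ B : Set Z, Sigma12 B → ∃ f : Z → X, Continuous f ∧ f ⁻¹' A = B

/-- The Ellentuck basic set `[σ,s]`: all infinite `a ⊆ ℕ` with `a ∩ {0,…,max σ} = σ`
and every element of `a` greater than `max σ` lying in `s` (stated max-free: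
`σ ⊆ a`, and every element of `a` outside `σ` lies in `s` and is above all of `σ`). -/
def ES (σ : Finset ℕ) (s : Set ℕ) : Set IOI :=
  {a | (∀ m ∈ σ, a.1 m = true) ∧
       ∀ n, a.1 n = true → n ∉ σ → n ∈ s ∧ ∀ m ∈ σ, m < n}

/-- A legitimate Ellentuck pair: `s` is infinite and `max σ < min s`. -/
def GoodPair (σ : Finset ℕ) (s : Set ℕ) : Prop :=
  s.Infinite ∧ ∀ m ∈ σ, ∀ n ∈ s, m < n

/-- `A ⊆ [ω]^ω` is Ramsey null if every Ellentuck basic set `[σ,s]` can be shrunk to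
`[σ,s']` (with `s' ⊆ s` infinite, `min s' > max σ`) disjoint from `A`. -/
def RamseyNull (A : Set IOI) : Prop :=
  ∀ σ : Finset ℕ, ∀ s : Set ℕ, GoodPair σ s →
    ∃ s' ⊆ s, s'.Infinite ∧ (∀ m ∈ σ, ∀ n ∈ s', m < n) ∧ ES σ s' ∩ A = ∅

/-- `A` is Ramsey positive if it is not Ramsey null. -/
def RamseyPositive (A : Set IOI) : Prop := ¬ RamseyNull A

open Set Filter Topology

theorem Set.Infinite.inter_Ioi {s : Set ℕ} (hs : s.Infinite) (m : ℕ) : (s ∩ Ioi m).Infinite := by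
  rw [Set.infinite_iff_exists_gt]
  intro a
  obtain ⟨b, hb, hab⟩ := hs.exists_gt (max a m)
  exact ⟨b, ⟨hb, lt_of_le_of_lt (le_max_right _ _) hab⟩, lt_of_le_of_lt (le_max_left _ _) hab⟩

/-- Diagonalization: properties that are inherited by subsets and can be achieved by shrinking can
be achieved simultaneously, the `m`-th one beyond `m`. -/
theorem exists_diagonal {Q : ℕ → Set ℕ → Prop} {s : Set ℕ} (hs : s.Infinite)
    (mono : ∀ m u v, u ⊆ v → Q m v → Q m u)
    (dense : ∀ m, ∀ u ⊆ s, u.Infinite → ∃ v ⊆ u, v.Infinite ∧ Q m v) :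
    ∃ u ⊆ s, u.Infinite ∧ ∀ m ∈ u, Q m (u ∩ Ioi m) := by
  have step : ∀ u : {u : Set ℕ // u ⊆ s ∧ u.Infinite}, ∃ v : {u : Set ℕ // u ⊆ s ∧ u.Infinite},
      v.1 ⊆ u.1 ∩ Ioi (sInf u.1) ∧ Q (sInf u.1) v.1 := by
    rintro ⟨u, hus, hu⟩
    obtain ⟨v, hvu, hv, hQ⟩ := dense (sInf u) (u ∩ Ioi (sInf u))
      (inter_subset_left.trans hus) (hu.inter_Ioi _)
    exact ⟨⟨v, hvu.trans (inter_subset_left.trans hus), hv⟩, hvu, hQ⟩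
  choose g hg hgQ using step
  let S : ℕ → {u : Set ℕ // u ⊆ s ∧ u.Infinite} := fun n => g^[n] ⟨s, subset_rfl, hs⟩
  have hS : ∀ n, S (n + 1) = g (S n) := fun n => Function.iterate_succ_apply' _ _ _
  let x : ℕ → ℕ := fun n => sInf (S n).1
  have hx : ∀ n, x n ∈ (S n).1 := fun n => Nat.sInf_mem (S n).2.2.nonempty
  have anti : Antitone fun n => (S n).1 := antitone_nat_of_succ_le fun n => by
    rw [hS]; exact (hg _).trans inter_subset_left
  have xmono : StrictMono x := strictMono_nat_of_lt_succ fun n => by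
    have := hx (n + 1)
    rw [hS n] at this
    exact (hg _ this).2
  refine ⟨range x, ?_, infinite_range_of_injective xmono.injective, ?_⟩
  · rintro _ ⟨n, rfl⟩
    exact (S n).2.1 (hx n)
  · rintro _ ⟨n, rfl⟩
    refine mono _ _ _ ?_ (hgQ (S n))
    rintro _ ⟨⟨k, rfl⟩, hk⟩
    rw [← hS n]
    exact anti (Nat.succ_le_of_lt (xmono.lt_iff_lt.1 hk)) (hx k)

/-- Diagonalization over families of properties, finitely many of which are treated at a time. -/
theorem exists_diagonal_finset {ι : Type*} {P : ι → Set ℕ → Prop} (K : ℕ → Finset ι) {s : Set ℕ}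
    (hs : s.Infinite) (mono : ∀ i u v, u ⊆ v → P i v → P i u)
    (dense : ∀ i, ∀ u ⊆ s, u.Infinite → ∃ v ⊆ u, v.Infinite ∧ P i v) :
    ∃ u ⊆ s, u.Infinite ∧ ∀ m ∈ u, ∀ i ∈ K m, P i (u ∩ Ioi m) := by
  classical
  refine exists_diagonal (Q := fun m u => ∀ i ∈ K m, P i u) hs
    (fun m u v huv h i hi => mono i u v huv (h i hi)) fun m => ?_
  induction K m using Finset.induction_on with
  | empty => exact fun u _ hu => ⟨u, subset_rfl, hu, by simp⟩
  | insert i F _ ih =>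
    intro u hus hu
    obtain ⟨v, hvu, hv, hP⟩ := ih u hus hu
    obtain ⟨w, hwv, hw, hPw⟩ := dense i v (hvu.trans hus) hv
    refine ⟨w, hwv.trans hvu, hw, fun j hj => ?_⟩
    rcases Finset.mem_insert.1 hj with rfl | hj
    · exact hPw
    · exact mono j w v hwv (hP j hj)

/-- The finite index set treated at stage `m` of a diagonalization over pairs consisting of a
finite set and a natural number. -/
def stage (m : ℕ) : Finset (Finset ℕ × ℕ) :=
  (Finset.range (m + 1)).powerset ×ˢ Finset.range (m + 1)

theorem mem_stage {m : ℕ} {τ : Finset ℕ} {i : ℕ} :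
    (τ, i) ∈ stage m ↔ (∀ n ∈ τ, n ≤ m) ∧ i ≤ m := by
  simp [stage, Finset.subset_iff]

theorem exists_mem_stage {u : Set ℕ} (hu : u.Infinite) (τ : Finset ℕ) (i : ℕ) :
    ∃ m ∈ u, (τ, i) ∈ stage m := by
  obtain ⟨m, hm, h⟩ := hu.exists_gt (max (τ.sup id) i)
  refine ⟨m, hm, mem_stage.2 ⟨fun n hn => ?_, ((le_max_right _ _).trans_lt h).le⟩⟩
  exact (Finset.le_sup (f := id) hn).trans ((le_max_left _ _).trans_lt h).le

theorem ES_mono {τ : Finset ℕ} {u v : Set ℕ} (h : u ⊆ v) : ES τ u ⊆ ES τ v :=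
  fun _ ha => ⟨ha.1, fun n hn hτ => ⟨h (ha.2 n hn hτ).1, (ha.2 n hn hτ).2⟩⟩

theorem ES_nonempty {τ : Finset ℕ} {u : Set ℕ} (h : GoodPair τ u) : (ES τ u).Nonempty := by
  classical
  refine ⟨⟨fun n => decide (n ∈ τ ∨ n ∈ u), h.1.mono fun n hn => by simp [hn]⟩, ?_, ?_⟩
  · intro m hm
    simp [hm]
  · intro n hn hτ
    have hu : n ∈ u := by simpa [hτ] using hn
    exact ⟨hu, fun m hm => h.2 m hm n hu⟩

/-- `X` meets every Ellentuck set `[τ,u]` with `u ⊆ s`. -/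
def Meets (X : Set IOI) (τ : Finset ℕ) (s : Set ℕ) : Prop :=
  ∀ u ⊆ s, u.Infinite → (ES τ u ∩ X).Nonempty

theorem Meets.mono {X : Set IOI} {τ : Finset ℕ} {s u : Set ℕ} (h : Meets X τ s) (hu : u ⊆ s) :
    Meets X τ u :=
  fun v hv => h v (hv.trans hu)

/-- Every finite stem is decided for every `X i`, up to finitely many elements of `s`. -/
def Decides (X : ℕ → Set IOI) (s : Set ℕ) : Prop :=
  ∀ τ i, ¬ Meets (X i) τ s → ∃ m, Disjoint (ES τ (s ∩ Ioi m)) (X i)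

theorem Decides.meets_iff {X : ℕ → Set IOI} {s u : Set ℕ} (h : Decides X s) (hus : u ⊆ s)
    (hu : u.Infinite) (τ : Finset ℕ) (i : ℕ) : Meets (X i) τ u ↔ Meets (X i) τ s := by
  refine ⟨fun hm => ?_, fun hm => hm.mono hus⟩
  by_contra hn
  obtain ⟨m, hd⟩ := h τ i hn
  obtain ⟨a, ha, haX⟩ := hm (u ∩ Ioi m) inter_subset_left (hu.inter_Ioi m)
  exact disjoint_left.1 hd (ES_mono (inter_subset_inter_left _ hus) ha) haX

theorem Decides.mono {X : ℕ → Set IOI} {s u : Set ℕ} (h : Decides X s) (hus : u ⊆ s)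
    (hu : u.Infinite) : Decides X u := by
  intro τ i hn
  rw [h.meets_iff hus hu] at hn
  obtain ⟨m, hd⟩ := h τ i hn
  exact ⟨m, hd.mono_left (ES_mono (inter_subset_inter_left _ hus))⟩

theorem exists_decides (X : ℕ → Set IOI) {s : Set ℕ} (hs : s.Infinite) :
    ∃ u ⊆ s, u.Infinite ∧ Decides X u := by
  obtain ⟨u, hus, hu, h⟩ := exists_diagonal_finset
    (P := fun (p : Finset ℕ × ℕ) v => Meets (X p.2) p.1 v ∨ Disjoint (ES p.1 v) (X p.2))
    stage hs
    (fun p u v huv => Or.imp (fun h => h.mono huv) fun h => h.mono_left (ES_mono huv))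
    (fun p u _ hu => by
      by_cases hm : Meets (X p.2) p.1 u
      · exact ⟨u, subset_rfl, hu, Or.inl hm⟩
      · unfold Meets at hm
        push Not at hm
        obtain ⟨v, hvu, hv, he⟩ := hm
        exact ⟨v, hvu, hv, Or.inr (disjoint_iff_inter_eq_empty.2 he)⟩)
  refine ⟨u, hus, hu, fun τ i hn => ?_⟩
  obtain ⟨m, hm, hst⟩ := exists_mem_stage hu τ i
  refine ⟨m, (h m hm (τ, i) hst).resolve_left fun hM => hn fun v hvu hv => ?_⟩
  obtain ⟨a, ha, haX⟩ := hM (v ∩ Ioi m) (inter_subset_inter_left _ hvu) (hv.inter_Ioi m)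
  exact ⟨a, ES_mono inter_subset_left ha, haX⟩

/-- Adding one element beyond the stem to the stem usually does not change the decision. -/
theorem Decides.exists_insert_iff {X : ℕ → Set IOI} {s : Set ℕ} (h : Decides X s) (τ : Finset ℕ)
    (i : ℕ) {u : Set ℕ} (hus : u ⊆ s) (hu : u.Infinite) :
    ∃ v ⊆ u, v.Infinite ∧ ∀ n ∈ v, (Meets (X i) (insert n τ) s ↔ Meets (X i) τ s) := by
  by_cases hM : Meets (X i) τ s
  · by_cases hG : {n ∈ u | Meets (X i) (insert n τ) s}.Infinite
    · exact ⟨_, sep_subset _ _, hG, fun n hn => iff_of_true hn.2 hM⟩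
    exfalso
    have hv : {n ∈ u | ¬ Meets (X i) (insert n τ) s}.Infinite := by
      refine (hu.sdiff (not_infinite.1 hG)).mono fun n hn => ⟨hn.1, fun hn' => hn.2 ⟨hn.1, hn'⟩⟩
    obtain ⟨w, hwv, hw, hd⟩ := exists_diagonal
      (Q := fun n w => ¬ Meets (X i) (insert n τ) s → Disjoint (ES (insert n τ) w) (X i)) hv
      (fun n w w' hww' h hn => (h hn).mono_left (ES_mono hww'))
      (fun n w hwv hw => by
        by_cases hn : Meets (X i) (insert n τ) s
        · exact ⟨w, subset_rfl, hw, fun h => absurd hn h⟩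
        · obtain ⟨m, hd⟩ := h _ i hn
          exact ⟨w ∩ Ioi m, inter_subset_left, hw.inter_Ioi m, fun _ => hd.mono_left
            (ES_mono (inter_subset_inter_left _ (hwv.trans ((sep_subset _ _).trans hus))))⟩)
    obtain ⟨a, ha, haX⟩ := hM w (hwv.trans ((sep_subset _ _).trans hus)) hw
    have hne : {n | a.1 n = true ∧ n ∉ τ}.Nonempty := by
      obtain ⟨n, hn, hn'⟩ := (a.2.sdiff τ.finite_toSet).nonempty
      exact ⟨n, hn, hn'⟩
    have hmem := Nat.sInf_mem hne
    set n := sInf {n | a.1 n = true ∧ n ∉ τ} with hndef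
    have hnw := ha.2 n hmem.1 hmem.2
    refine disjoint_left.1 (hd n hnw.1 (hwv hnw.1).2) ⟨fun k hk => ?_, fun k hk hk' => ?_⟩ haX
    · rcases Finset.mem_insert.1 hk with rfl | hk
      · exact hmem.1
      · exact ha.1 k hk
    · rw [Finset.mem_insert, not_or] at hk'
      have hkw := ha.2 k hk hk'.2
      have hnk : n < k := lt_of_le_of_ne (Nat.sInf_le ⟨hk, hk'.2⟩) (Ne.symm hk'.1)
      refine ⟨⟨hkw.1, hnk⟩, fun m hm => ?_⟩
      rcases Finset.mem_insert.1 hm with rfl | hm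
      · exact hnk
      · exact hkw.2 m hm
  · obtain ⟨m, hd⟩ := h τ i hM
    refine ⟨u ∩ Ioi (max m (τ.sup id)), inter_subset_left, hu.inter_Ioi _, fun n hn =>
      iff_of_false (fun hM' => ?_) hM⟩
    have hmn : m < n := (le_max_left _ _).trans_lt hn.2
    obtain ⟨a, ha, haX⟩ := hM' (u ∩ Ioi m) (inter_subset_left.trans hus) (hu.inter_Ioi m)
    refine disjoint_left.1 hd ⟨fun k hk => ha.1 k (Finset.mem_insert_of_mem hk),
      fun k hk hkτ => ?_⟩ haX
    by_cases hkn : k = n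
    · subst hkn
      exact ⟨⟨hus hn.1, hmn⟩, fun l hl =>
        (Finset.le_sup (f := id) hl).trans_lt ((le_max_right _ _).trans_lt hn.2)⟩
    · have := ha.2 k hk (by simp [hkn, hkτ])
      exact ⟨inter_subset_inter_left _ hus this.1, fun l hl =>
        this.2 l (Finset.mem_insert_of_mem hl)⟩

/-- Decisions about `X i` do not change when a stem bounded by some `m ∈ s` with `i ≤ m` is
extended by elements of `s` beyond `m`. -/
def Stable (X : ℕ → Set IOI) (s : Set ℕ) : Prop :=
  ∀ m ∈ s, ∀ τ i, (τ, i) ∈ stage m → ∀ ρ : Finset ℕ, (∀ n ∈ ρ, n ∈ s ∩ Ioi m) →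
    (Meets (X i) (τ ∪ ρ) s ↔ Meets (X i) τ s)

theorem exists_decides_stable (X : ℕ → Set IOI) {s : Set ℕ} (hs : s.Infinite) :
    ∃ u ⊆ s, u.Infinite ∧ Decides X u ∧ Stable X u := by
  obtain ⟨u, hus, hu, hD⟩ := exists_decides X hs
  obtain ⟨v, hvu, hv, h⟩ := exists_diagonal_finset
    (P := fun (p : Finset ℕ × ℕ) w => ∀ n ∈ w,
      (Meets (X p.2) (insert n p.1) u ↔ Meets (X p.2) p.1 u))
    stage hu
    (fun p w w' hw h n hn => h n (hw hn))
    (fun p w hw hwi => hD.exists_insert_iff p.1 p.2 hw hwi)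
  refine ⟨v, hvu.trans hus, hv, hD.mono hvu hv, fun m hm τ i hτ ρ => ?_⟩
  rw [hD.meets_iff hvu hv, hD.meets_iff hvu hv]
  rw [mem_stage] at hτ
  induction ρ using Finset.induction_on_max with
  | empty => simp
  | insert n ρ hn ih =>
    intro hρ
    have hρ' : ∀ k ∈ ρ, k ∈ v ∩ Ioi m := fun k hk => hρ k (Finset.mem_insert_of_mem hk)
    rw [← ih hρ', Finset.union_insert]
    obtain ⟨l, hlv, hml, hρl, hln⟩ : ∃ l ∈ v, m ≤ l ∧ (∀ k ∈ ρ, k ≤ l) ∧ l < n := by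
      rcases ρ.eq_empty_or_nonempty with rfl | hne
      · exact ⟨m, hm, le_rfl, by simp, (hρ n (Finset.mem_insert_self _ _)).2⟩
      · have hmem := ρ.max'_mem hne
        exact ⟨ρ.max' hne, (hρ' _ hmem).1, (hρ' _ hmem).2.le, fun k hk => ρ.le_max' k hk,
          hn _ hmem⟩
    refine h l hlv (τ ∪ ρ, i) (mem_stage.2 ⟨fun k hk => ?_, hτ.2.trans hml⟩) n
      ⟨(hρ n (Finset.mem_insert_self _ _)).1, hln⟩
    rcases Finset.mem_union.1 hk with hk | hk
    · exact (hτ.1 k hk).trans hml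
    · exact hρl k hk

/-- If each `X k` is null below every extension of `τ` inside `u`, then all of them can be avoided
at once. -/
theorem exists_disjoint_forall {X : ℕ → Set IOI} {τ : Finset ℕ} {u : Set ℕ} (hu : u.Infinite)
    (h : ∀ ρ : Finset ℕ, (∀ n ∈ ρ, n ∈ u) → ∀ k, ∃ m, Disjoint (ES (τ ∪ ρ) (u ∩ Ioi m)) (X k)) :
    ∃ v ⊆ u, v.Infinite ∧ ∀ k, Disjoint (ES τ v) (X k) := by
  obtain ⟨v, hvu, hv, hd⟩ := exists_diagonal_finset
    (P := fun (p : Finset ℕ × ℕ) w => (∀ n ∈ p.1, n ∈ u) → Disjoint (ES (τ ∪ p.1) w) (X p.2))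
    stage hu
    (fun p w w' hww' hp hρ => (hp hρ).mono_left (ES_mono hww'))
    (fun p w hwu hw => by
      by_cases hρ : ∀ n ∈ p.1, n ∈ u
      · obtain ⟨m, hm⟩ := h p.1 hρ p.2
        exact ⟨w ∩ Ioi m, inter_subset_left, hw.inter_Ioi m, fun _ =>
          hm.mono_left (ES_mono (inter_subset_inter_left _ hwu))⟩
      · exact ⟨w, subset_rfl, hw, fun h' => absurd h' hρ⟩)
  refine ⟨v, hvu, hv, fun k => disjoint_left.2 fun a ha haX => ?_⟩
  obtain ⟨m, hm, hst⟩ := exists_mem_stage hv ∅ k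
  rw [mem_stage] at hst
  let ρ := (Finset.range (m + 1)).filter fun n => a.1 n = true ∧ n ∉ τ
  have hρ : ∀ n, n ∈ ρ ↔ n ≤ m ∧ a.1 n = true ∧ n ∉ τ := fun n => by
    simp [ρ]
  refine disjoint_left.1 (hd m hm (ρ, k) (mem_stage.2 ⟨fun n hn => ((hρ n).1 hn).1, hst.2⟩)
    fun n hn => hvu (ha.2 n ((hρ n).1 hn).2.1 ((hρ n).1 hn).2.2).1) ⟨fun n hn => ?_,
    fun n hn hn' => ?_⟩ haX
  · rcases Finset.mem_union.1 hn with hn | hn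
    · exact ha.1 n hn
    · exact ((hρ n).1 hn).2.1
  · rw [Finset.mem_union, not_or, hρ] at hn'
    have hmn : m < n := by
      by_contra hc
      exact hn'.2 ⟨not_lt.1 hc, hn, hn'.1⟩
    have := ha.2 n hn hn'.1
    refine ⟨⟨this.1, hmn⟩, fun l hl => ?_⟩
    rcases Finset.mem_union.1 hl with hl | hl
    · exact this.2 l hl
    · exact ((hρ l).1 hl).1.trans_lt hmn

/-- The elements of `a` up to `m`. -/
def trace (a : IOI) (m : ℕ) : Finset ℕ := (Finset.range (m + 1)).filter fun n => a.1 n = true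

theorem mem_trace {a : IOI} {m n : ℕ} : n ∈ trace a m ↔ n ≤ m ∧ a.1 n = true := by
  simp [trace]

theorem trace_congr {a b : IOI} {m : ℕ} (h : ∀ n ≤ m, a.1 n = b.1 n) : trace a m = trace b m := by
  ext n
  rw [mem_trace, mem_trace]
  exact and_congr_right fun hn => by rw [h n hn]

theorem mem_ES_trace {a : IOI} {τ : Finset ℕ} {s : Set ℕ} (ha : a ∈ ES τ s) {m : ℕ}
    (hτ : ∀ n ∈ τ, n ≤ m) : a ∈ ES (trace a m) (s ∩ Ioi m) := by
  refine ⟨fun n hn => (mem_trace.1 hn).2, fun n hn hn' => ?_⟩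
  rw [mem_trace, not_and] at hn'
  have hmn : m < n := by
    by_contra hc
    exact hn' (not_lt.1 hc) hn
  exact ⟨⟨(ha.2 n hn fun h => absurd (hτ n h) (not_le.2 hmn)).1, hmn⟩,
    fun k hk => (mem_trace.1 hk).1.trans_lt hmn⟩

theorem eq_of_mem_ES_trace {a b : IOI} {s : Set ℕ} {m : ℕ} (hb : b ∈ ES (trace a m) (s ∩ Ioi m))
    {n : ℕ} (hn : n ≤ m) : b.1 n = a.1 n := by
  rw [Bool.eq_iff_iff]
  refine ⟨fun h => ?_, fun h => hb.1 n (mem_trace.2 ⟨hn, h⟩)⟩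
  by_contra hc
  exact absurd (hb.2 n h fun h' => hc (mem_trace.1 h').2).1.2 (not_lt.2 hn)

/-- `a` lies in the Ellentuck closure of `X`, as seen by `s`. -/
def Near (X : Set IOI) (s : Set ℕ) (a : IOI) : Prop :=
  ∀ᶠ m in atTop, Meets X (trace a m) s

theorem Stable.near_iff {X : ℕ → Set IOI} {s : Set ℕ} (h : Stable X s) {m : ℕ} (hm : m ∈ s)
    {τ : Finset ℕ} {i : ℕ} (hτ : (τ, i) ∈ stage m) {a : IOI} (ha : a ∈ ES τ (s ∩ Ioi m)) :
    Near (X i) s a ↔ Meets (X i) τ s := by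
  have key : ∀ j ≥ m, (Meets (X i) (trace a j) s ↔ Meets (X i) τ s) := by
    intro j hj
    have hEq : trace a j = τ ∪ (trace a j).filter fun n => n ∉ τ := by
      ext n
      simp only [Finset.mem_union, Finset.mem_filter]
      constructor
      · intro hn
        by_cases hnτ : n ∈ τ
        · exact Or.inl hnτ
        · exact Or.inr ⟨hn, hnτ⟩
      · rintro (hn | hn)
        · exact mem_trace.2 ⟨((mem_stage.1 hτ).1 n hn).trans hj, ha.1 n hn⟩
        · exact hn.1
    rw [hEq]
    refine h m hm τ i hτ _ fun n hn => ?_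
    rw [Finset.mem_filter] at hn
    exact (ha.2 n (mem_trace.1 hn.1).2 hn.2).1
  refine ⟨fun hN => ?_, fun hM => ?_⟩
  · obtain ⟨j, hj, hmj⟩ := (hN.and (eventually_ge_atTop m)).exists
    exact (key j hmj).1 hj
  · filter_upwards [eventually_ge_atTop m] with j hj using (key j hj).2 hM

/-- If `X i ⊆ ⋃ k, X (j k)`, then the points near `X i` but near no `X (j k)` form a set that can be
avoided below every stem. -/
theorem not_meets_near_diff {X : ℕ → Set IOI} {s : Set ℕ} (hD : Decides X s) (hS : Stable X s)
    {i : ℕ} {j : ℕ → ℕ} (hX : X i ⊆ ⋃ k, X (j k)) {N : ℕ → Set IOI} {l : ℕ}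
    (hN : N l ⊆ {a | Near (X i) s a ∧ ∀ k, ¬ Near (X (j k)) s a})
    {u : Set ℕ} (hus : u ⊆ s) (hu : u.Infinite) (hSN : Stable N u) (τ : Finset ℕ) :
    ¬ Meets (N l) τ u := by
  intro hM
  have near : ∀ (τ' : Finset ℕ) (i' : ℕ), Meets (N l) τ' u →
      ∃ a ∈ N l, (Near (X i') s a ↔ Meets (X i') τ' s) := by
    intro τ' i' hM'
    obtain ⟨m, hm, hst⟩ := exists_mem_stage hu τ' i'
    obtain ⟨a, ha, haN⟩ := hM' (u ∩ Ioi m) inter_subset_left (hu.inter_Ioi m)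
    exact ⟨a, haN, hS.near_iff (hus hm) hst (ES_mono (inter_subset_inter_left _ hus) ha)⟩
  obtain ⟨m, hm, hst⟩ := exists_mem_stage hu τ l
  have hτi : Meets (X i) τ s := by
    obtain ⟨a, haN, hiff⟩ := near τ i hM
    exact hiff.1 (hN haN).1
  obtain ⟨v, hvu, hv, hd⟩ := exists_disjoint_forall (X := fun k => X (j k)) (τ := τ)
    (hu.inter_Ioi m) fun ρ hρ k => by
      obtain ⟨a, haN, hiff⟩ := near (τ ∪ ρ) (j k) ((hSN m hm τ l hst ρ hρ).2 hM)
      obtain ⟨m', hm'⟩ := hD _ _ fun h => (hN haN).2 k (hiff.2 h)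
      exact ⟨m', hm'.mono_left
        (ES_mono (inter_subset_inter_left _ (inter_subset_left.trans hus)))⟩
  obtain ⟨a, ha, haX⟩ := hτi v (hvu.trans (inter_subset_left.trans hus)) hv
  obtain ⟨k, hk⟩ := mem_iUnion.1 (hX haX)
  exact disjoint_left.1 (hd k) ha hk

/-- A scheme of sets with positive root has, on some Ellentuck set, a pruned tree of approximations
that depends continuously on the point. -/
theorem exists_pruned_scheme {A : List ℕ → Set IOI} (hA : ∀ t, A t ⊆ ⋃ k, A (t ++ [k]))
    {σ : Finset ℕ} {s : Set ℕ} (hs : s.Infinite) (hM : Meets (A []) σ s) :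
    ∃ (u : Set ℕ) (R : IOI → List ℕ → Prop), GoodPair σ u ∧
      ∀ a ∈ ES σ u, R a [] ∧ ∀ t,
        (R a t → ∃ k, R a (t ++ [k])) ∧
        (∃ m, ∀ b ∈ ES σ u, (∀ n ≤ m, b.1 n = a.1 n) → (R b t ↔ R a t)) ∧
        (R a t → ∀ m, ∃ b ∈ A t, ∀ n ≤ m, b.1 n = a.1 n) := by
  let X : ℕ → Set IOI := fun i => A (Denumerable.ofNat (List ℕ) i)
  have hXe : ∀ t, X (Encodable.encode t) = A t := fun t => by simp [X]
  obtain ⟨s₁, hs₁s, hs₁, hD, hS⟩ := exists_decides_stable X hs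
  let N : ℕ → Set IOI := fun i => {a | Near (X i) s₁ a ∧
    ∀ k, ¬ Near (X (Encodable.encode (Denumerable.ofNat (List ℕ) i ++ [k]))) s₁ a}
  obtain ⟨s₂, hs₂s, hs₂, hDN, hSN⟩ := exists_decides_stable N hs₁
  have hnull : ∀ τ i, ¬ Meets (N i) τ s₂ := fun τ i =>
    not_meets_near_diff hD hS (by simpa only [hXe] using hA _) subset_rfl hs₂s hs₂ hSN τ
  obtain ⟨m₀, hm₀, hst₀⟩ := exists_mem_stage hs₁ σ (Encodable.encode ([] : List ℕ))
  obtain ⟨u, hus, hu, hd⟩ := exists_disjoint_forall (X := N) (τ := σ) (hs₂.inter_Ioi m₀)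
    fun ρ _ i => by
      obtain ⟨m, hm⟩ := hDN _ _ (hnull (σ ∪ ρ) i)
      exact ⟨m, hm.mono_left (ES_mono (inter_subset_inter_left _ inter_subset_left))⟩
  have hus₁ : u ⊆ s₁ ∩ Ioi m₀ := hus.trans (inter_subset_inter_left _ hs₂s)
  have loc : ∀ a ∈ ES σ u, ∀ t m, ∃ j ≥ m, j ∈ s₁ ∧ ∀ b ∈ ES σ u, (∀ n ≤ j, b.1 n = a.1 n) →
      (Near (A t) s₁ b ↔ Meets (A t) (trace a j) s₁) := by
    intro a _ t m
    obtain ⟨j, hj, hst⟩ := exists_mem_stage hs₁ (insert m σ) (Encodable.encode t)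
    rw [mem_stage] at hst
    refine ⟨j, hst.1 m (Finset.mem_insert_self _ _), hj, fun b hb hab => ?_⟩
    have := hS.near_iff hj (mem_stage.2 ⟨fun n hn => (mem_trace.1 hn).1, hst.2⟩)
      (ES_mono (inter_subset_inter_left _ (hus₁.trans inter_subset_left))
        (mem_ES_trace hb fun n hn => hst.1 n (Finset.mem_insert_of_mem hn)))
    rwa [hXe, trace_congr hab] at this
  refine ⟨u, fun a t => Near (A t) s₁ a,
    ⟨hu, fun m hm n hn => ((mem_stage.1 hst₀).1 m hm).trans_lt (hus hn).2⟩,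
    fun a ha => ⟨?_, fun t => ⟨fun hR => ?_, ?_, fun hR m => ?_⟩⟩⟩
  · have := hS.near_iff hm₀ hst₀ (ES_mono hus₁ ha)
    rw [hXe] at this
    exact this.2 (hM.mono hs₁s)
  · by_contra hc
    push Not at hc
    refine disjoint_left.1 (hd (Encodable.encode t)) ha ⟨by rwa [hXe], fun k => ?_⟩
    rw [hXe, Denumerable.ofNat_encode]
    exact hc k
  · obtain ⟨j, -, -, h⟩ := loc a ha t 0
    exact ⟨j, fun b hb hab => (h b hb hab).trans (h a ha fun _ _ => rfl).symm⟩
  · obtain ⟨j, hmj, -, h⟩ := loc a ha t m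
    obtain ⟨b, hb, hbA⟩ := (h a ha fun _ _ => rfl).1 hR (s₁ ∩ Ioi j) inter_subset_left
      (hs₁.inter_Ioi j)
    exact ⟨b, hbA, fun n hn => eq_of_mem_ES_trace hb (hn.trans hmj)⟩

theorem eventually_eq_up_to (a : IOI) (m : ℕ) : ∀ᶠ b in 𝓝 a, ∀ n ≤ m, b.1 n = a.1 n := by
  refine (eventually_all_finite (finite_Iic m)).2 fun n _ => ?_
  have hc : Continuous fun b : IOI => b.1 n := (continuous_apply n).comp continuous_subtype_val
  exact hc.continuousAt.eventually_mem (isOpen_discrete {a.1 n} |>.mem_nhds rfl)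

/-- The leftmost branch, up to length `n`, of the tree `R`. -/
noncomputable def leftmost (R : List ℕ → Prop) : ℕ → List ℕ
  | 0 => []
  | n + 1 => leftmost R n ++ [sInf {k | R (leftmost R n ++ [k])}]

/-- The leftmost branch of the tree `R`. -/
noncomputable def leftmostBranch (R : List ℕ → Prop) (n : ℕ) : ℕ :=
  sInf {k | R (leftmost R n ++ [k])}

theorem leftmost_eq_map (R : List ℕ → Prop) (n : ℕ) :
    leftmost R n = (List.range n).map (leftmostBranch R) := by
  induction n with
  | zero => rfl
  | succ n ih => rw [List.range_succ, List.map_append, ← ih]; rfl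

theorem leftmost_mem {R : List ℕ → Prop} (h₀ : R []) (h : ∀ t, R t → ∃ k, R (t ++ [k])) (n : ℕ) :
    R (leftmost R n) := by
  induction n with
  | zero => exact h₀
  | succ n ih => exact Nat.sInf_mem (s := {k | R (leftmost R n ++ [k])}) (h _ ih)

theorem sInf_eq_of_forall_le {S T : Set ℕ} (hS : S.Nonempty) (h : ∀ k ≤ sInf S, k ∈ T ↔ k ∈ S) :
    sInf T = sInf S := by
  have hmem : sInf S ∈ T := (h _ le_rfl).2 (Nat.sInf_mem hS)
  refine le_antisymm (Nat.sInf_le hmem) (Nat.sInf_le ?_)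
  exact (h _ (Nat.sInf_le hmem)).1 (Nat.sInf_mem ⟨_, hmem⟩)

theorem eventually_leftmost_eq {Y : Type*} {F : Filter Y} {R : List ℕ → Prop}
    {R' : Y → List ℕ → Prop} (h₀ : R []) (h : ∀ t, R t → ∃ k, R (t ++ [k]))
    (hR : ∀ t, ∀ᶠ b in F, (R' b t ↔ R t)) (n : ℕ) :
    ∀ᶠ b in F, leftmost (R' b) n = leftmost R n ∧
      leftmostBranch (R' b) n = leftmostBranch R n := by
  have branch : ∀ n, (∀ᶠ b in F, leftmost (R' b) n = leftmost R n) →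
      ∀ᶠ b in F, leftmostBranch (R' b) n = leftmostBranch R n := by
    intro n hn
    have hfin : ∀ᶠ b in F, ∀ k ∈ Iic (leftmostBranch R n),
        (R' b (leftmost R n ++ [k]) ↔ R (leftmost R n ++ [k])) :=
      (eventually_all_finite (finite_Iic _)).2 fun k _ => hR _
    filter_upwards [hn, hfin] with b hb hk
    unfold leftmostBranch
    rw [hb]
    exact sInf_eq_of_forall_le (h _ (leftmost_mem h₀ h n)) fun k hk' => hk k hk'
  have stem_eq : ∀ n, ∀ᶠ b in F, leftmost (R' b) n = leftmost R n := by
    intro n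
    induction n with
    | zero => exact Eventually.of_forall fun _ => rfl
    | succ n ih =>
      filter_upwards [ih, branch n ih] with b hb hb'
      change leftmost (R' b) n ++ [leftmostBranch (R' b) n] =
        leftmost R n ++ [leftmostBranch R n]
      rw [hb, hb']
  exact (stem_eq n).and (branch n (stem_eq n))

/-- For a closed `D ⊆ [ω]^ω × ℕ^ℕ` with projection `A`: `A` is Ramsey positive iff
there are an Ellentuck basic set `[σ,s]` and a continuous `f : [σ,s] → ℕ^ℕ` whose
graph is contained in `D`. -/
theorem statement13 (D : Set (IOI × (ℕ → ℕ))) (hD : IsClosed D) :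
    RamseyPositive (Prod.fst '' D) ↔
      ∃ (σ : Finset ℕ) (s : Set ℕ), GoodPair σ s ∧
        ∃ f : IOI → (ℕ → ℕ), ContinuousOn f (ES σ s) ∧
          ∀ a ∈ ES σ s, (a, f a) ∈ D := by
  constructor
  · intro hpos
    unfold RamseyPositive RamseyNull at hpos
    push Not at hpos
    obtain ⟨σ, s, hσs, h⟩ := hpos
    let A : List ℕ → Set IOI := fun t => {a | ∃ x, (a, x) ∈ D ∧ (List.range t.length).map x = t}
    have hA : ∀ t, A t ⊆ ⋃ k, A (t ++ [k]) := by
      rintro t a ⟨x, hx, hxt⟩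
      refine mem_iUnion.2 ⟨x t.length, x, hx, ?_⟩
      rw [List.length_append, List.length_singleton, List.range_succ, List.map_append, hxt]
      rfl
    have hM : Meets (A []) σ s := by
      intro u hus hu
      obtain ⟨a, ha, ⟨_, x⟩, hx, rfl⟩ := h u hus hu fun m hm n hn => hσs.2 m hm n (hus hn)
      exact ⟨_, ha, x, hx, rfl⟩
    obtain ⟨u, R, hu, hR⟩ := exists_pruned_scheme hA hσs.1 hM
    refine ⟨σ, u, hu, fun a => leftmostBranch (R a), fun a ha => ?_, fun a ha => ?_⟩
    · refine tendsto_pi_nhds.2 fun n => ?_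
      refine tendsto_nhds_of_eventually_eq ?_
      refine (eventually_leftmost_eq (hR a ha).1 (fun t => ((hR a ha).2 t).1) (fun t => ?_)
        n).mono fun b hb => hb.2
      obtain ⟨m, hm⟩ := ((hR a ha).2 t).2.1
      filter_upwards [nhdsWithin_le_nhds (eventually_eq_up_to a m), self_mem_nhdsWithin]
        with b hb hbu using hm b hbu hb
    · have hT := leftmost_mem (hR a ha).1 fun t => ((hR a ha).2 t).1
      choose b hbA hb using fun n => ((hR a ha).2 _).2.2 (hT n) n
      choose x hxD hx using hbA
      have hxn : ∀ n, ∀ k < n, x n k = leftmostBranch (R a) k := by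
        intro n k hk
        have := hx n
        rw [leftmost_eq_map, List.length_map, List.length_range] at this
        exact List.map_inj_left.1 this k (List.mem_range.2 hk)
      refine hD.mem_of_tendsto (b := atTop) (f := fun n => (b n, x n))
        (Tendsto.prodMk_nhds ?_ ?_) (Eventually.of_forall hxD)
      · refine tendsto_subtype_rng.2 (tendsto_pi_nhds.2 fun k => ?_)
        refine tendsto_nhds_of_eventually_eq ?_
        filter_upwards [eventually_ge_atTop k] with n hn using hb n k hn
      · refine tendsto_pi_nhds.2 fun k => tendsto_nhds_of_eventually_eq ?_
        filter_upwards [eventually_gt_atTop k] with n hn using hxn n k hn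
  · rintro ⟨σ, s, hσs, f, -, hf⟩ hnull
    obtain ⟨u, hus, hu, hσu, he⟩ := hnull σ s hσs
    obtain ⟨a, ha⟩ := ES_nonempty ⟨hu, hσu⟩
    exact eq_empty_iff_forall_notMem.1 he a ⟨ha, _, hf a (ES_mono hus ha), rfl⟩
end

section
/- The set {z ∈ 𝒞 : G_z is Ramsey positive} is not Δ¹₂; that is, it is not the case that both this set and its complement in 𝒞 are Σ¹₂. -/
open MeasureTheory TopologicalSpace

/-- A pruned tree of strictly increasing finite sequences of naturals: nonempty
(contains the empty sequence), all members strictly increasing, closed under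
initial segments, and every member has a proper extension in the tree. -/
def PrunedIncTree (T : List ℕ → Bool) : Prop :=
  T [] = true ∧
  (∀ l, T l = true → List.Chain' (· < ·) l) ∧
  (∀ l n, T (l ++ [n]) = true → T l = true) ∧
  (∀ l, T l = true → ∃ n, T (l ++ [n]) = true)

/-- The initial segment of length `k` of the increasing enumeration of `a ∈ [ω]^ω`. -/
noncomputable def enumList (a : IOI) (k : ℕ) : List ℕ :=
  (List.range k).map (Nat.nth fun n => a.1 n = true)

/-- The closed set `C_T ⊆ [ω]^ω` coded by `T`: all `a` all of whose
increasing-enumeration initial segments lie in `T`. -/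
def treeClosedSet (T : List ℕ → Bool) : Set IOI :=
  {a | ∀ k, T (enumList a k) = true}

/-- The space `𝒞` of `G_δ`-codes: sequences of pruned trees of strictly increasing
finite sequences, topologized as a subspace of `(2^(ℕ^{<ℕ}))^ℕ`. -/
abbrev GdCode := {z : ℕ → List ℕ → Bool // ∀ n, PrunedIncTree (z n)}

/-- The `G_δ` set coded by `z`: `G_z = [ω]^ω \ ⋃ n, C_{T_n}`. -/
def Gdelta (z : GdCode) : Set IOI := (⋃ n, treeClosedSet (z.1 n))ᶜ

/-- The fixed countable subbase of `𝒞`: the sets `{z : σ ∈ T_{z,n}}` and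
`{z : σ ∉ T_{z,n}}` for `n ∈ ℕ` and finite strictly increasing `σ`. -/
def codeSubbase : ℕ × {σ : List ℕ // List.Chain' (· < ·) σ} × Bool → Set GdCode :=
  fun p => {z | z.1 p.1 p.2.1.1 = p.2.2}

/-- A number coding the length-`n` restrictions of `p`, `c` and `w`. -/
def prefixCode (p c : ℕ → Bool) (w : ℕ → ℕ) (n : ℕ) : ℕ :=
  Encodable.encode ((List.range n).map p, (List.range n).map c, (List.range n).map w)

theorem prefixCode_eq_iff {p c p' c' : ℕ → Bool} {w w' : ℕ → ℕ} {n n' : ℕ} :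
    prefixCode p c w n = prefixCode p' c' w' n' ↔
      n = n' ∧ ∀ i < n, p i = p' i ∧ c i = c' i ∧ w i = w' i := by
  unfold prefixCode
  rw [Encodable.encode_inj, Prod.mk.injEq, Prod.mk.injEq]
  constructor
  · rintro ⟨h1, h2, h3⟩
    obtain rfl : n = n' := by simpa using congrArg List.length h1
    rw [List.map_inj_left] at h1 h2 h3
    exact ⟨rfl, fun i hi => ⟨h1 i (by simpa using hi), h2 i (by simpa using hi),
      h3 i (by simpa using hi)⟩⟩
  · rintro ⟨rfl, h⟩
    simp only [List.map_inj_left, List.mem_range]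
    exact ⟨fun i hi => (h i hi).1, fun i hi => (h i hi).2.1, fun i hi => (h i hi).2.2⟩

theorem prefixCode_congr {p c c' : ℕ → Bool} {w w' : ℕ → ℕ} {n : ℕ}
    (hc : ∀ i < n, c i = c' i) (hw : ∀ i < n, w i = w' i) :
    prefixCode p c w n = prefixCode p c' w' n :=
  prefixCode_eq_iff.2 ⟨rfl, fun i hi => ⟨rfl, hc i hi, hw i hi⟩⟩

theorem continuous_prefixCode (n : ℕ) :
    Continuous fun q : (ℕ → Bool) × (ℕ → Bool) × (ℕ → ℕ) => prefixCode q.1 q.2.1 q.2.2 n := by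
  refine continuous_iff_continuousAt.2 fun q => tendsto_nhds_of_eventually_eq ?_
  have h : ∀ i ∈ Set.Iio n, ∀ᶠ r in nhds q,
      (r.1 i, r.2.1 i, r.2.2 i) = (q.1 i, q.2.1 i, q.2.2 i) := fun i _ => by
    have hc : Continuous fun r : (ℕ → Bool) × (ℕ → Bool) × (ℕ → ℕ) =>
        (r.1 i, r.2.1 i, r.2.2 i) := by fun_prop
    have := hc.continuousAt (x := q)
    rwa [ContinuousAt, nhds_discrete (Bool × Bool × ℕ), Filter.tendsto_pure] at this
  filter_upwards [(Filter.eventually_all_finite (Set.finite_Iio n)).2 h] with r hr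
  exact prefixCode_eq_iff.2 ⟨rfl, fun i hi => by simpa using hr i hi⟩

/-- Every closed set of triples is the set of branches of a tree. -/
theorem exists_prefixCode_of_isClosed
    {F : Set ((ℕ → Bool) × (ℕ → Bool) × (ℕ → ℕ))} (hF : IsClosed F) :
    ∃ x : ℕ → Bool, ∀ p c w, (p, c, w) ∈ F ↔ ∀ n, x (prefixCode p c w n) = true := by
  classical
  refine ⟨fun m => decide (∃ p c w n, (p, c, w) ∈ F ∧ m = prefixCode p c w n), fun p c w => ?_⟩
  simp only [decide_eq_true_eq]
  refine ⟨fun h n => ⟨p, c, w, n, h, rfl⟩, fun h => ?_⟩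
  choose p' c' w' n' hmem heq using h
  simp only [prefixCode_eq_iff] at heq
  refine hF.mem_of_tendsto (f := fun n => (p' n, c' n, w' n)) (b := Filter.atTop) ?_
    (Filter.Eventually.of_forall hmem)
  refine Filter.Tendsto.prodMk_nhds ?_ (Filter.Tendsto.prodMk_nhds ?_ ?_) <;>
  · refine tendsto_pi_nhds.2 fun i => tendsto_nhds_of_eventually_eq ?_
    filter_upwards [Filter.eventually_gt_atTop i] with n hn
    simp [(heq n).2 i hn]

/-- The point of Cantor space attached to a natural number. -/
def cantorPoint (e i : ℕ) : Bool :=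
  decide (i ∈ Denumerable.ofNat (List ℕ) (Nat.unpair (e / 2)).1)

theorem frequently_cantorPoint (c : ℕ → Bool) (j : ℕ) :
    ∃ᶠ e in Filter.atTop, ¬ Odd e ∧ ∀ i < j, cantorPoint e i = c i := by
  rw [Filter.frequently_atTop]
  intro N
  refine ⟨2 * Nat.pair (Encodable.encode ((List.range j).filter fun i => c i)) N,
    ?_, by simp, fun i hi => ?_⟩
  · have := Nat.right_le_pair
      (Encodable.encode ((List.range j).filter fun i => c i)) N
    show N ≤ _
    omega
  · have h := Denumerable.ofNat_encode ((List.range j).filter fun i => c i)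
    simp only [cantorPoint, Nat.mul_div_cancel_left _ two_pos, Nat.unpair_pair]
    erw [h]
    simp [hi]

/-- The condition imposed by the `k`-th tree attached to `x` on the first `n + k + 1` terms
of a sequence `b`: an odd term occurs, or the tree coded by `x` has a node of length `n` which,
past the first `k` terms, is bounded by `b`. -/
def BoundedNode (x : ℕ → Bool) (k n : ℕ) (b : ℕ → ℕ) : Prop :=
  (∃ i ≤ n + k, Odd (b i)) ∨
    ∃ v : List ℕ, (∀ i < n, v.getD i 0 ≤ b (k + i)) ∧
      ∀ m ≤ n, x (prefixCode x (cantorPoint (b (n + k))) (fun i => v.getD i 0) m) = true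

theorem BoundedNode.congr {x : ℕ → Bool} {k n : ℕ} {b b' : ℕ → ℕ}
    (h : ∀ i ≤ n + k, b i = b' i) (hb : BoundedNode x k n b) : BoundedNode x k n b' := by
  rcases hb with ⟨i, hi, ho⟩ | ⟨v, hv, hx⟩
  · exact Or.inl ⟨i, hi, h i hi ▸ ho⟩
  · refine Or.inr ⟨v, fun i hi => ?_, ?_⟩
    · rw [← h (k + i) (by omega)]; exact hv i hi
    · rw [← h (n + k) le_rfl]; exact hx

open Classical in
/-- The `k`-th tree attached to `x`. -/
noncomputable def codeTree (x : ℕ → Bool) (k : ℕ) (l : List ℕ) : Bool :=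
  decide (List.IsChain (· < ·) l ∧
    ∀ n, n + k < l.length → BoundedNode x k n (fun i => l.getD i 0))

theorem codeTree_eq_true {x : ℕ → Bool} {k : ℕ} {l : List ℕ} :
    codeTree x k l = true ↔ List.IsChain (· < ·) l ∧
      ∀ n, n + k < l.length → BoundedNode x k n (fun i => l.getD i 0) := by
  simp [codeTree]

theorem prunedIncTree_codeTree (x : ℕ → Bool) (k : ℕ) : PrunedIncTree (codeTree x k) := by
  refine ⟨codeTree_eq_true.2 ⟨List.isChain_nil, by simp⟩, fun l h => (codeTree_eq_true.1 h).1,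
    fun l n h => ?_, fun l h => ?_⟩
  · obtain ⟨h1, h2⟩ := codeTree_eq_true.1 h
    refine codeTree_eq_true.2 ⟨(List.isChain_append.1 h1).1, fun m hm => ?_⟩
    refine (h2 m (by simp; omega)).congr fun i hi => ?_
    exact List.getD_append _ _ _ _ (by omega)
  · obtain ⟨h1, h2⟩ := codeTree_eq_true.1 h
    refine ⟨2 * l.sum + 1, codeTree_eq_true.2 ⟨?_, fun m hm => ?_⟩⟩
    · refine List.isChain_append.2 ⟨h1, List.isChain_singleton _, fun a ha b hb => ?_⟩
      have := List.le_sum_of_mem (List.mem_of_mem_getLast? ha)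
      simp at hb
      omega
    · rcases lt_or_ge (m + k) l.length with hlt | hge
      · exact (h2 m hlt).congr fun i hi => (List.getD_append _ _ _ _ (by omega)).symm
      · exact Or.inl ⟨l.length, hge, by simp⟩

/-- The `G_δ`-code attached to `x`. -/
noncomputable def codeOf (x : ℕ → Bool) : GdCode :=
  ⟨codeTree x, prunedIncTree_codeTree x⟩

theorem continuous_apply_prefixCode (c : ℕ → Bool) (w : ℕ → ℕ) (n : ℕ) :
    Continuous fun x : ℕ → Bool => x (prefixCode x c w n) := by
  have hp : Continuous fun x : ℕ → Bool => prefixCode x c w n :=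
    (continuous_prefixCode n).comp (f := fun x : ℕ → Bool => (x, c, w)) (by fun_prop)
  refine continuous_iff_continuousAt.2 fun x =>
    (continuous_apply (prefixCode x c w n)).continuousAt.congr ?_
  have := hp.continuousAt (x := x)
  rw [ContinuousAt, nhds_discrete ℕ, Filter.tendsto_pure] at this
  filter_upwards [this] with y hy
  rw [hy]

theorem measurableSet_codeTree (k : ℕ) (l : List ℕ) :
    MeasurableSet {x | codeTree x k l = true} := by
  simp only [codeTree_eq_true, BoundedNode, Set.ofPred_and, Set.ofPred_forall, Set.ofPred_or,
    Set.ofPred_exists]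
  refine (MeasurableSet.const _).inter (MeasurableSet.iInter fun n => MeasurableSet.iInter
    fun _ => MeasurableSet.union ?_ (MeasurableSet.iUnion fun v =>
      (MeasurableSet.iInter fun _ => MeasurableSet.iInter fun _ => MeasurableSet.const _).inter
      (MeasurableSet.iInter fun m => MeasurableSet.iInter fun _ => ?_)))
  · exact MeasurableSet.iUnion fun _ => (MeasurableSet.const _).inter (MeasurableSet.const _)
  · exact (continuous_apply_prefixCode _ _ _).measurable (measurableSet_singleton true)

/-- The increasing enumeration of an infinite set. -/
noncomputable def enum (a : IOI) : ℕ → ℕ := Nat.nth fun n => a.1 n = true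

theorem enum_strictMono (a : IOI) : StrictMono (enum a) := Nat.nth_strictMono a.2

theorem apply_enum (a : IOI) (i : ℕ) : a.1 (enum a i) = true :=
  Nat.nth_mem_of_infinite a.2 i

theorem mem_treeClosedSet_codeTree {x : ℕ → Bool} {k : ℕ} {a : IOI} :
    a ∈ treeClosedSet (codeTree x k) ↔ ∀ n, BoundedNode x k n (enum a) := by
  have hget : ∀ j i, i < j → (enumList a j).getD i 0 = enum a i := by
    intro j i hi
    simp [enumList, enum, List.getD_eq_getElem?_getD, hi]
  constructor
  · intro h n
    exact ((codeTree_eq_true.1 (h (n + k + 1))).2 n (by simp [enumList])).congr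
      fun i hi => hget _ _ (by omega)
  · intro h j
    refine codeTree_eq_true.2 ⟨?_, fun n hn => (h n).congr fun i hi => ?_⟩
    · rw [List.isChain_iff_pairwise]
      exact (List.pairwise_lt_range).map _ fun _ _ hab => enum_strictMono a hab
    · exact (hget _ _ (by simp [enumList] at hn; omega)).symm

theorem enum_card_add_mem {σ : Finset ℕ} {s : Set ℕ} {a : IOI} (ha : a ∈ ES σ s) (i : ℕ) :
    enum a (σ.card + i) ∈ s := by
  obtain ⟨j, hj, hjσ⟩ : ∃ j ≤ σ.card, enum a j ∉ σ := by
    by_contra! h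
    have := Finset.card_le_card (s := (Finset.range (σ.card + 1)).image (enum a)) (t := σ)
      (by
        intro m hm
        obtain ⟨j, hj, rfl⟩ := Finset.mem_image.1 hm
        exact h j (by simpa [Nat.lt_succ_iff] using hj))
    rw [Finset.card_image_of_injective _ (enum_strictMono a).injective,
      Finset.card_range] at this
    omega
  refine (ha.2 _ (apply_enum a _) fun hmem => ?_).1
  have h1 := (ha.2 _ (apply_enum a j) hjσ).2 _ hmem
  have h2 := (enum_strictMono a).monotone (show j ≤ σ.card + i by omega)
  omega

/-- A strictly increasing sequence in the range of another one grows at least as fast. -/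
theorem exists_ge_of_strictMono_of_mem_range {e ψ : ℕ → ℕ} (he : StrictMono e)
    (hψ : StrictMono ψ) (h : ∀ n, ψ n ∈ Set.range e) (n : ℕ) : ∃ j ≥ n, ψ n = e j := by
  choose j hj using h
  have hmono : StrictMono j := fun m n hmn => by
    rw [← he.lt_iff_lt, hj, hj]; exact hψ hmn
  exact ⟨j n, hmono.id_le n, (hj n).symm⟩

/-- If every `c` admits a branch of the tree coded by `x`, the coded set is Ramsey null. -/
theorem ramseyNull_of_forall_exists {x : ℕ → Bool}
    (h : ∀ c, ∃ w, ∀ n, x (prefixCode x c w n) = true) : RamseyNull (Gdelta (codeOf x)) := by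
  rintro σ s ⟨hs, hσ⟩
  obtain ⟨c, φ, hφ, hc⟩ :=
    CompactSpace.tendsto_subseq fun i => cantorPoint (Nat.nth (· ∈ s) i)
  obtain ⟨w, hw⟩ := h c
  have hsm : StrictMono fun i => Nat.nth (· ∈ s) (φ i) := (Nat.nth_strictMono hs).comp hφ
  obtain ⟨ψ, hψ, hψw⟩ := Filter.extraction_forall_of_eventually
    (P := fun j i => w j ≤ Nat.nth (· ∈ s) (φ i) ∧
      ∀ m < j, cantorPoint (Nat.nth (· ∈ s) (φ i)) m = c m) (fun j => by
      refine (hsm.tendsto_atTop.eventually_ge_atTop _).and ?_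
      have : ∀ m ∈ Set.Iio j, ∀ᶠ i in Filter.atTop,
          cantorPoint (Nat.nth (· ∈ s) (φ i)) m = c m := fun m _ => by
        have := tendsto_pi_nhds.1 hc m
        rw [nhds_discrete, Filter.tendsto_pure] at this
        exact this
      exact (Filter.eventually_all_finite (Set.finite_Iio j)).2 this)
  have he := hsm.comp hψ
  set e := (fun i => Nat.nth (· ∈ s) (φ i)) ∘ ψ
  have hsub : Set.range e ⊆ s := by
    rintro _ ⟨i, rfl⟩
    exact Nat.nth_mem_of_infinite hs _
  refine ⟨Set.range e, hsub, Set.infinite_range_of_injective he.injective,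
    fun m hm n hn => hσ m hm n (hsub hn), ?_⟩
  refine Set.disjoint_iff_inter_eq_empty.1 (Set.disjoint_left.2 fun a ha hG => hG ?_)
  refine Set.mem_iUnion.2 ⟨σ.card, mem_treeClosedSet_codeTree.2 fun n => Or.inr ?_⟩
  have hE : ∀ n, ∃ j ≥ n, enum a (σ.card + n) = e j :=
    exists_ge_of_strictMono_of_mem_range he
      (fun m n hmn => enum_strictMono a (by omega)) (enum_card_add_mem ha)
  refine ⟨(List.range n).map w, fun i hi => ?_, fun m hm => ?_⟩
  · obtain ⟨j, hj, hej⟩ := hE i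
    rw [hej]
    have := (hψw i).1.trans (he.monotone hj)
    simpa [List.getD_eq_getElem?_getD, hi] using this
  · obtain ⟨j, hj, hej⟩ := hE n
    rw [add_comm n, hej, ← hw m]
    refine congrArg x (prefixCode_congr (fun i hi => (hψw j).2 i (by omega)) fun i hi => ?_)
    simp [List.getD_eq_getElem?_getD, hi.trans_le hm]

/-- König's lemma for a closed set of bounded branches. -/
theorem exists_branch_of_bounded {x p c : ℕ → Bool} {b : ℕ → ℕ}
    (h : ∀ n, ∃ u : ℕ → ℕ, (∀ i < n, u i ≤ b i) ∧
      ∀ m ≤ n, x (prefixCode p c u m) = true) :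
    ∃ w, ∀ n, x (prefixCode p c w n) = true := by
  have hloc : ∀ n, Continuous fun u : ℕ → ℕ => prefixCode p c u n := fun n =>
    (continuous_prefixCode n).comp (f := fun u : ℕ → ℕ => (p, c, u)) (by fun_prop)
  have hcl : ∀ n, IsClosed {u : ℕ → ℕ | ∀ m ≤ n, x (prefixCode p c u m) = true} := fun n => by
    simp only [Set.ofPred_forall]
    exact isClosed_iInter fun m => isClosed_iInter fun _ =>
      isClosed_eq (continuous_of_discreteTopology.comp (hloc m)) continuous_const
  have hK : IsCompact (Set.univ.pi fun i => Set.Iic (b i)) :=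
    isCompact_univ_pi fun i => (Set.finite_Iic (b i)).isCompact
  obtain ⟨w, hw⟩ := IsCompact.nonempty_iInter_of_sequence_nonempty_isCompact_isClosed
    (fun n => (Set.univ.pi fun i => Set.Iic (b i)) ∩
      {u : ℕ → ℕ | ∀ m ≤ n, x (prefixCode p c u m) = true})
    (fun n u hu => ⟨hu.1, fun m hm => hu.2 m (by omega)⟩)
    (fun n => by
      obtain ⟨u, hu, hx⟩ := h n
      refine ⟨fun i => if i < n then u i else 0, fun i _ => ?_, fun m hm => ?_⟩
      · by_cases hi : i < n <;> simp [hi, hu]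
      · rw [← hx m hm]
        exact congrArg x (prefixCode_congr (fun _ _ => rfl) fun i hi => by
          simp [hi.trans_le hm]))
    (hK.inter_right (hcl 0))
    (fun n => hK.isClosed.inter (hcl n))
  exact ⟨w, fun n => (Set.mem_iInter.1 hw n).2 n le_rfl⟩

/-- If some `c` admits no branch of the tree coded by `x`, the coded set is Ramsey positive. -/
theorem ramseyPositive_of_exists_forall {x : ℕ → Bool}
    (h : ∃ c, ¬ ∃ w, ∀ n, x (prefixCode x c w n) = true) :
    RamseyPositive (Gdelta (codeOf x)) := by
  obtain ⟨c, hc⟩ := h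
  intro hnull
  obtain ⟨e, he, hec⟩ := Filter.extraction_forall_of_frequently (frequently_cantorPoint c)
  obtain ⟨s', hs', hinf, -, hdisj⟩ := hnull ∅ (Set.range e)
    ⟨Set.infinite_range_of_injective he.injective, by simp⟩
  classical
  let a : IOI := ⟨fun n => decide (n ∈ s'), by simpa using hinf⟩
  have haE : a ∈ ES ∅ s' := ⟨by simp, fun n hn _ => ⟨by simpa [a] using hn, by simp⟩⟩
  have haG : a ∉ Gdelta (codeOf x) := fun hG => by
    simpa [hdisj] using (show a ∈ ES ∅ s' ∩ Gdelta (codeOf x) from ⟨haE, hG⟩)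
  obtain ⟨k, hk⟩ := Set.mem_iUnion.1 (not_not.1 haG)
  have hmem : ∀ i, enum a i ∈ Set.range e := fun i =>
    hs' (by simpa [a] using apply_enum a i)
  refine hc (exists_branch_of_bounded (b := fun i => enum a (k + i)) fun n => ?_)
  rcases mem_treeClosedSet_codeTree.1 hk n with ⟨i, -, ho⟩ | ⟨v, hv, hx⟩
  · obtain ⟨j, hj⟩ := hmem i
    exact absurd (hj ▸ ho) (hec j).1
  · refine ⟨fun i => v.getD i 0, hv, fun m hm => ?_⟩
    obtain ⟨j, hj, hej⟩ := exists_ge_of_strictMono_of_mem_range he (enum_strictMono a) hmem (n + k)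
    rw [← hx m hm, hej]
    exact congrArg x (prefixCode_congr (fun i hi => ((hec j).2 i (by omega)).symm)
      fun _ _ => rfl)

theorem ramseyPositive_codeOf_iff {x : ℕ → Bool} :
    RamseyPositive (Gdelta (codeOf x)) ↔ ∃ c, ¬ ∃ w, ∀ n, x (prefixCode x c w n) = true := by
  refine ⟨fun h => ?_, ramseyPositive_of_exists_forall⟩
  by_contra! hc
  exact h (ramseyNull_of_forall_exists hc)

/-- An analytic subset of a product is the projection of a closed set. -/
theorem exists_isClosed_of_analyticSet {X Y : Type*} [TopologicalSpace X] [TopologicalSpace Y]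
    [T2Space X] [T2Space Y] {A : Set (X × Y)} (hA : AnalyticSet A) :
    ∃ F : Set (X × Y × (ℕ → ℕ)), IsClosed F ∧ ∀ x y, (x, y) ∈ A ↔ ∃ w, (x, y, w) ∈ F := by
  rw [AnalyticSet] at hA
  rcases hA with rfl | ⟨h, hcont, rfl⟩
  · exact ⟨∅, isClosed_empty, by simp⟩
  · exact ⟨{q | h q.2.2 = (q.1, q.2.1)}, isClosed_eq (by fun_prop) (by fun_prop), by simp⟩

instance polishSpace_nat_bool : PolishSpace (ℕ → Bool) where

theorem analyticSet_of_sigma12 {C : Set (ℕ → ℕ)} {f : (ℕ → ℕ) → GdCode}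
    (hC : AnalyticSet Cᶜ) (hf : Continuous f) (φ : (ℕ → Bool) ≃ᵐ (ℕ → ℕ)) :
    AnalyticSet {q : (ℕ → Bool) × (ℕ → Bool) | ¬ (f (φ q.2) = codeOf q.1 ∧ φ q.2 ∈ C)} := by
  have hmeas : MeasurableSet {q : (ℕ → Bool) × (ℕ → Bool) | f (φ q.2) = codeOf q.1} := by
    have : {q : (ℕ → Bool) × (ℕ → Bool) | f (φ q.2) = codeOf q.1} =
        ⋂ k, ⋂ l, {q | (f (φ q.2)).1 k l = (codeOf q.1).1 k l} := by
      ext q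
      simp [Subtype.ext_iff, funext_iff]
    rw [this]
    refine MeasurableSet.iInter fun k => MeasurableSet.iInter fun l => measurableSet_eq_fun ?_ ?_
    · have : Continuous fun y => (f y).1 k l :=
        (continuous_apply l).comp ((continuous_apply k).comp (continuous_subtype_val.comp hf))
      exact this.measurable.comp (φ.measurable.comp measurable_snd)
    · have : Measurable fun x => (codeOf x).1 k l :=
        measurable_to_bool (measurableSet_codeTree k l)
      exact this.comp measurable_fst
  have hφC : AnalyticSet (φ ⁻¹' Cᶜ) := by
    rw [AnalyticSet] at hC
    rcases hC with h | ⟨g, hg, h⟩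
    · rw [h]; exact analyticSet_empty
    · have : φ ⁻¹' Cᶜ = (φ.symm ∘ g) '' Set.univ := by
        rw [← h, Set.image_univ, Set.range_comp, φ.symm.image_eq_preimage_symm, φ.symm_symm]
      rw [this]
      exact MeasurableSet.univ.analyticSet_image (φ.symm.measurable.comp hg.measurable)
  have hunion : AnalyticSet (⋃ b : Bool, cond b
      {q : (ℕ → Bool) × (ℕ → Bool) | f (φ q.2) = codeOf q.1}ᶜ (Prod.snd ⁻¹' (φ ⁻¹' Cᶜ))) :=
    AnalyticSet.iUnion fun b => by
      cases b
      · exact hφC.preimage continuous_snd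
      · exact hmeas.compl.analyticSet
  rw [← Set.union_eq_iUnion] at hunion
  convert hunion using 1
  ext q
  simp [imp_iff_not_or]

/-- The set of codes of Ramsey positive `G_δ` sets is not `Δ¹₂`. -/
theorem statement14 :
    ¬ (Sigma12 {z : GdCode | RamseyPositive (Gdelta z)} ∧
       Sigma12 {z : GdCode | RamseyPositive (Gdelta z)}ᶜ) := by
  rintro ⟨-, C, f, hC, hf, him⟩
  have φ : (ℕ → Bool) ≃ᵐ (ℕ → ℕ) := PolishSpace.measurableEquivOfNotCountable
    (by rw [← Cardinal.mk_le_aleph0_iff, not_le]; simp [Cardinal.aleph0_lt_continuum])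
    (by rw [← Cardinal.mk_le_aleph0_iff, not_le]; simp [Cardinal.aleph0_lt_continuum])
  obtain ⟨F, hF, hAF⟩ := exists_isClosed_of_analyticSet (analyticSet_of_sigma12 hC hf φ)
  obtain ⟨x, hx⟩ := exists_prefixCode_of_isClosed hF
  have key : RamseyPositive (Gdelta (codeOf x)) ↔ ¬ RamseyPositive (Gdelta (codeOf x)) := by
    have : codeOf x ∈ f '' C ↔ ¬ RamseyPositive (Gdelta (codeOf x)) := by rw [him]; rfl
    rw [← this, ramseyPositive_codeOf_iff]
    simp only [← hx, ← hAF, Set.mem_ofPred_eq, not_not, Set.mem_image]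
    constructor
    · rintro ⟨c, h1, h2⟩
      exact ⟨φ c, h2, h1⟩
    · rintro ⟨y, h1, h2⟩
      exact ⟨φ.symm y, by simpa using h2, by simpa using h1⟩
  tauto
end
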